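/- Assume Condition (D). Let Ψ_1, Ψ_2 be a pair of Young functions and let f : X → ℝ be measurable with ‖f‖_W < ∞, where W(x) = Ψ_2(φ(V(x))/φ(1)). Then for any probability measures μ_1, μ_2 on X with μ_1(V) + μ_2(V) < ∞, Σ_{n=0}^∞ Ψ_1(r(n)) |μ_1(P^(n) f) − μ_2(P^(n) f)| ≤ c · (μ_1(V) + μ_2(V) − 1) · ‖f‖_W, where c is the explicit constant c = (2/(ε_b φ(1)))[2 + b̄/ε_ν + c_* b̄ r(1)(1 + r(1)/(ε_b φ(1)))]. -/

import Mathlib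

open MeasureTheory ProbabilityTheory Filter Set

noncomputable def iterKernel {X : Type*} [MeasurableSpace X]
    (P : ℕ → Kernel X X) : ℕ → Kernel X X
  | 0 => Kernel.id
  | n + 1 => (P (n + 1)).comp (iterKernel P n)

noncomputable def Hfun (φ : ℝ → ℝ) (t : ℝ) : ℝ := ∫ s in (1:ℝ)..t, (φ s)⁻¹

noncomputable def Hinv (φ : ℝ → ℝ) : ℝ → ℝ := Function.invFunOn (Hfun φ) (Set.Ici 1)

noncomputable def rate (φ : ℝ → ℝ) (εb : ℝ) (n : ℕ) : ℝ := φ (Hinv φ (εb * n)) / φ 1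

noncomputable def deltaSeq (φ : ℝ → ℝ) (εb : ℝ) (k : ℕ) : ℝ := εb * deriv φ (Hinv φ (εb * k))

noncomputable def bbar (φ : ℝ → ℝ) (εb bV : ℝ) : ℝ := 2 * bV + εb * φ 1

noncomputable def Mone (φ : ℝ → ℝ) (εb εν bV cV : ℝ) : ℝ :=
  rate φ εb 1 * (1 + 2 * rate φ εb 1 / (εb * φ 1) * ((bV + cV) / (1 - εν) - 1))

noncomputable def cstar (φ : ℝ → ℝ) (εb εν bV cV : ℝ) : ℝ :=
  ∑' j : ℕ, (1 - εν) ^ j * ∏ k ∈ Finset.Icc 1 j, (1 + deltaSeq φ εb k * Mone φ εb εν bV cV)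

noncomputable def cconst (φ : ℝ → ℝ) (εb εν bV cV : ℝ) : ℝ :=
  2 / (εb * φ 1) * (2 + bbar φ εb bV / εν +
    cstar φ εb εν bV cV * bbar φ εb bV * rate φ εb 1 * (1 + rate φ εb 1 / (εb * φ 1)))

noncomputable def Qmeas {X : Type*} [MeasurableSpace X]
    (P : ℕ → Kernel X X) (ν : ℕ → Measure X) (εν : ℝ) (k : ℕ) (x : X) : Measure X :=
  (ENNReal.ofReal (1 - εν))⁻¹ • (P k x - ENNReal.ofReal εν • ν k)

/-- The growth condition on the drift function of a subgeometric drift inequality. -/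
structure IsDriftFunction (φ : ℝ → ℝ) : Prop where
  concave : ConcaveOn ℝ (Set.Ici 1) φ
  mono : MonotoneOn φ (Set.Ici 1)
  diff : ∀ t, 1 ≤ t → DifferentiableAt ℝ φ t
  pos : ∀ t, 1 ≤ t → 0 < φ t
  deriv_tendsto : Tendsto (deriv φ) atTop (nhds 0)

/-- The extension of a function on `[1, ∞)` to the left by a constant. -/
noncomputable def extendLeft (φ : ℝ → ℝ) (t : ℝ) : ℝ := φ (max t 1)

lemma extendLeft_of_le {φ : ℝ → ℝ} {t : ℝ} (ht : 1 ≤ t) : extendLeft φ t = φ t := by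
  simp [extendLeft, ht]

lemma extendLeft_of_ge {φ : ℝ → ℝ} {t : ℝ} (ht : t ≤ 1) : extendLeft φ t = φ 1 := by
  simp [extendLeft, ht]

/-- If `f` has an antitone derivative on `[a, ∞)`, it lies below its tangents. -/
lemma le_tangent_of_antitoneOn {f f' : ℝ → ℝ} {c : ℝ} (hf : ∀ x, HasDerivAt f (f' x) x)
    (hf' : AntitoneOn f' (Ici c)) {a y : ℝ} (ha : c ≤ a) (hy : c ≤ y) :
    f y ≤ f a + f' a * (y - a) := by
  have hcont : Continuous f := continuous_iff_continuousAt.2 fun x => (hf x).continuousAt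
  have hdiff : Differentiable ℝ f := fun x => (hf x).differentiableAt
  rcases le_total a y with h | h
  · have := (convex_Icc a y).image_sub_le_mul_sub_of_deriv_le (C := f' a) hcont.continuousOn
      hdiff.differentiableOn (fun x hx => by
        rw [interior_Icc] at hx
        rw [(hf x).deriv]
        exact hf' ha (ha.trans hx.1.le) hx.1.le) a ⟨le_rfl, h⟩ y ⟨h, le_rfl⟩ h
    linarith
  · have := (convex_Icc y a).mul_sub_le_image_sub_of_le_deriv (C := f' a) hcont.continuousOn
      hdiff.differentiableOn (fun x hx => by
        rw [interior_Icc] at hx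
        rw [(hf x).deriv]
        exact hf' (hy.trans hx.1.le) ha hx.2.le) y ⟨le_rfl, h⟩ a ⟨h, le_rfl⟩ h
    linarith

namespace IsDriftFunction

variable {φ : ℝ → ℝ}

lemma deriv_antitoneOn (h : IsDriftFunction φ) : AntitoneOn (deriv φ) (Ici 1) :=
  h.concave.antitoneOn_deriv h.diff

lemma deriv_nonneg (h : IsDriftFunction φ) {t : ℝ} (ht : 1 ≤ t) : 0 ≤ deriv φ t := by
  refine le_of_tendsto h.deriv_tendsto ?_
  filter_upwards [eventually_ge_atTop t] with s hs
  exact h.deriv_antitoneOn ht (ht.trans hs) hs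

lemma le_tangent (h : IsDriftFunction φ) {t : ℝ} (ht : 1 ≤ t) :
    φ t ≤ φ 1 + deriv φ 1 * (t - 1) := by
  have := (convex_Icc 1 t).image_sub_le_mul_sub_of_deriv_le (C := deriv φ 1) (f := φ)
    (fun x hx => (h.diff x hx.1).continuousAt.continuousWithinAt)
    (fun x hx => by
      rw [interior_Icc] at hx
      exact (h.diff x hx.1.le).differentiableWithinAt)
    (fun x hx => by
      rw [interior_Icc] at hx
      exact h.deriv_antitoneOn (le_refl (1:ℝ)) hx.1.le hx.1.le) 1 ⟨le_rfl, ht⟩ t ⟨ht, le_rfl⟩ ht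
  linarith

lemma le_linear (h : IsDriftFunction φ) {t : ℝ} (ht : 1 ≤ t) :
    φ t ≤ (φ 1 + deriv φ 1) * t := by
  nlinarith [h.le_tangent ht, h.pos 1 le_rfl, h.deriv_nonneg le_rfl]

lemma extend_pos (h : IsDriftFunction φ) (t : ℝ) : 0 < extendLeft φ t := h.pos _ (le_max_right _ _)

lemma extend_continuous (h : IsDriftFunction φ) : Continuous (extendLeft φ) := by
  have : ContinuousOn φ (Ici 1) := fun x hx => (h.diff x hx).continuousAt.continuousWithinAt
  exact this.comp_continuous (by fun_prop) fun x => le_max_right x 1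

lemma extend_mono (h : IsDriftFunction φ) : Monotone (extendLeft φ) := fun a b hab =>
  h.mono (le_max_right a 1) (le_max_right b 1) (max_le_max_right 1 hab)

lemma subadd (h : IsDriftFunction φ) {a b : ℝ} (ha : 1 ≤ a) (hb : 1 ≤ b) :
    φ (a + b - 1) + φ 1 ≤ φ a + φ b := by
  have := (convex_Ici (0 : ℝ)).image_sub_le_mul_sub_of_deriv_le (C := 0)
    (f := fun s => φ (a + s) - φ (1 + s)) (fun x hx => by
      have hx : 0 ≤ x := hx
      refine ContinuousAt.continuousWithinAt (ContinuousAt.sub ?_ ?_)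
      · exact ContinuousAt.comp (f := fun s : ℝ => a + s) (h.diff _ (by linarith)).continuousAt
          (by fun_prop)
      · exact ContinuousAt.comp (f := fun s : ℝ => 1 + s) (h.diff _ (by linarith)).continuousAt
          (by fun_prop))
    (fun x hx => by
      rw [interior_Ici] at hx
      have hx : 0 < x := hx
      refine DifferentiableAt.differentiableWithinAt (DifferentiableAt.sub ?_ ?_)
      · exact DifferentiableAt.comp (f := fun s : ℝ => a + s) x (h.diff _ (by linarith))
          (by fun_prop)
      · exact DifferentiableAt.comp (f := fun s : ℝ => 1 + s) x (h.diff _ (by linarith))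
          (by fun_prop))
    (fun x hx => by
      rw [interior_Ici] at hx
      have hx : 0 < x := hx
      have h1 : HasDerivAt (fun s => φ (a + s)) (deriv φ (a + x)) x :=
        (h.diff (a + x) (by linarith)).hasDerivAt.comp_const_add a x
      have h2 : HasDerivAt (fun s => φ (1 + s)) (deriv φ (1 + x)) x :=
        (h.diff (1 + x) (by linarith)).hasDerivAt.comp_const_add 1 x
      have h3 : deriv (fun s => φ (a + s) - φ (1 + s)) x = deriv φ (a + x) - deriv φ (1 + x) :=
        (h1.sub h2).deriv
      rw [h3]
      have := h.deriv_antitoneOn (show (1:ℝ) ≤ 1 + x by linarith)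
        (show (1:ℝ) ≤ a + x by linarith) (by linarith)
      linarith) 0 (by simp) (b - 1) (by simpa using hb) (by linarith)
  have e1 : a + (b - 1) = a + b - 1 := by ring
  have e2 : 1 + (b - 1) = b := by ring
  simp only [e1, e2, add_zero, zero_mul] at this
  linarith

/-- The primitive `H` of `1 / φ`, extended to the real line, and its inverse flow `G`. -/
lemma exists_flow (h : IsDriftFunction φ) : ∃ H G : ℝ → ℝ,
    (∀ t, HasDerivAt H (extendLeft φ t)⁻¹ t) ∧ (∀ t, HasDerivAt G (extendLeft φ (G t)) t) ∧
    (∀ t, G (H t) = t) ∧ (∀ t, H (G t) = t) ∧ H 1 = 0 ∧ StrictMono H ∧ StrictMono G ∧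
    ∀ t, 0 ≤ t → Hinv φ t = G t := by
  set H : ℝ → ℝ := fun t => ∫ s in (1:ℝ)..t, (extendLeft φ s)⁻¹ with hH
  have hcont : Continuous fun s => (extendLeft φ s)⁻¹ :=
    h.extend_continuous.inv₀ fun s => (h.extend_pos s).ne'
  have hd : ∀ t, HasDerivAt H (extendLeft φ t)⁻¹ t := fun t =>
    (hcont.integral_hasStrictDerivAt 1 t).hasDerivAt
  have hmono : StrictMono H := strictMono_of_deriv_pos fun t => by
    rw [(hd t).deriv]; exact inv_pos.2 (h.extend_pos t)
  have hHc : Continuous H := continuous_iff_continuousAt.2 fun x => (hd x).continuousAt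
  have hB : 0 < φ 1 + deriv φ 1 := by linarith [h.pos 1 le_rfl, h.deriv_nonneg le_rfl]
  have htop : Tendsto H atTop atTop := by
    refine tendsto_atTop_mono' (f₁ := fun t => (φ 1 + deriv φ 1)⁻¹ * Real.log t) atTop ?_
      (Real.tendsto_log_atTop.const_mul_atTop (inv_pos.2 hB))
    filter_upwards [eventually_ge_atTop 1] with t ht
    have hint : ∫ s in (1:ℝ)..t, (φ 1 + deriv φ 1)⁻¹ * s⁻¹ =
        (φ 1 + deriv φ 1)⁻¹ * Real.log t := by
      rw [intervalIntegral.integral_const_mul, integral_inv_of_pos one_pos (by linarith)]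
      simp
    rw [← hint]
    refine intervalIntegral.integral_mono_on ht ?_ (hcont.intervalIntegrable _ _) fun s hs => ?_
    · refine ContinuousOn.intervalIntegrable fun s hs => ?_
      rw [uIcc_of_le ht] at hs
      refine ContinuousAt.continuousWithinAt (ContinuousAt.mul continuousAt_const ?_)
      exact continuousAt_inv₀ (by linarith [hs.1])
    · rw [extendLeft_of_le hs.1, ← mul_inv]
      exact inv_anti₀ (h.pos s hs.1) (h.le_linear hs.1)
  have hbot : Tendsto H atBot atBot := by
    have : (fun t => (φ 1)⁻¹ * (t - 1)) =ᶠ[atBot] H := by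
      filter_upwards [eventually_le_atBot 1] with t ht
      have : H t = ∫ s in (1:ℝ)..t, (φ 1)⁻¹ := by
        refine intervalIntegral.integral_congr fun s hs => ?_
        rw [uIcc_of_ge ht] at hs
        simp only [extendLeft_of_ge hs.2]
      rw [this, intervalIntegral.integral_const, smul_eq_mul, mul_comm]
    refine Tendsto.congr' this ?_
    refine Tendsto.const_mul_atBot (inv_pos.2 (h.pos 1 le_rfl)) ?_
    exact tendsto_atBot_add_const_right _ _ tendsto_id
  have hsurj := hHc.surjective htop hbot
  set e := hmono.orderIsoOfSurjective H hsurj with he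
  have heH : ∀ t, e t = H t := fun t => rfl
  have hHG : ∀ t, H (e.symm t) = t := fun t => by rw [← heH]; simp
  have hGH : ∀ t, e.symm (H t) = t := fun t => by rw [← heH]; simp
  have hH1 : H 1 = 0 := by simp [hH]
  refine ⟨H, e.symm, hd, fun t => ?_, hGH, hHG, hH1, hmono, e.symm.strictMono, fun t ht => ?_⟩
  · have := HasDerivAt.of_local_left_inverse (e.symm.continuous.continuousAt) (hd (e.symm t))
      (inv_ne_zero (h.extend_pos _).ne') (Eventually.of_forall hHG)
    simpa using this
  · have hEq : ∀ a, 1 ≤ a → Hfun φ a = H a := fun a ha => by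
      refine intervalIntegral.integral_congr fun s hs => ?_
      rw [uIcc_of_le ha] at hs
      simp only [extendLeft_of_le hs.1]
    have h1 : 1 ≤ e.symm t := by
      rw [← hmono.le_iff_le, hH1, hHG]; exact ht
    have hex : ∃ a ∈ Ici (1:ℝ), Hfun φ a = t := ⟨e.symm t, h1, by rw [hEq _ h1, hHG]⟩
    have hmem : 1 ≤ Hinv φ t := Function.invFunOn_mem hex
    have heq : Hfun φ (Hinv φ t) = t := Function.invFunOn_eq hex
    rw [hEq _ hmem] at heq
    rw [← hmono.injective.eq_iff, heq, hHG]

end IsDriftFunction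

/-- Deterministic facts about the rate `r n = φ (H⁻¹ (ε n)) / φ 1` and the family of concave
functions `h n w = H⁻¹ (H w + ε n) - H⁻¹ (ε n)`, with slopes `s n`. -/
structure RateFamily (φ : ℝ → ℝ) (ε : ℝ) (r δ : ℕ → ℝ) (h s : ℕ → ℝ → ℝ) : Prop where
  rate_zero : r 0 = 1
  one_le_rate : ∀ n, 1 ≤ r n
  ratio_le : ∀ m n, m ≤ n → r (n + 1) / r n ≤ r (m + 1) / r m
  rate_mono : ∀ n, r n ≤ r (n + 1)
  rate_sub_le : ∀ n, r (n + 1) - r n ≤ δ n * r (n + 1)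
  delta_nonneg : ∀ n, 0 ≤ δ n
  delta_antitone : Antitone δ
  delta_tendsto : Tendsto δ atTop (nhds 0)
  measurable : ∀ n, Measurable (h n)
  at_one : ∀ n, h n 1 = 0
  nonneg : ∀ n a, 1 ≤ a → 0 ≤ h n a
  zero_eq : ∀ a, 1 ≤ a → h 0 a = a - 1
  slope_nonneg : ∀ n a, 1 ≤ a → 0 ≤ s n a
  slope_le : ∀ n a, 1 ≤ a → s n a ≤ r n
  le_tangent : ∀ n a y, 1 ≤ a → 1 ≤ y → h n y ≤ h n a + s n a * (y - a)
  descent : ∀ n a, 1 ≤ a → h (n + 1) a - ε * φ a * s (n + 1) a ≤ h n a - ε * φ 1 * r n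

lemma IsDriftFunction.exists_rateFamily {φ : ℝ → ℝ} (hφ : IsDriftFunction φ) {ε : ℝ}
    (hε : 0 < ε) : ∃ h s, RateFamily φ ε (rate φ ε) (deltaSeq φ ε) h s := by
  obtain ⟨H, G, hH, hG, hGH, hHG, hH1, hHm, hGm, hinv⟩ := hφ.exists_flow
  have hG0 : G 0 = 1 := by rw [← hH1, hGH]
  have hG1 : ∀ t, 0 ≤ t → 1 ≤ G t := fun t ht => hG0 ▸ hGm.monotone ht
  have hH0 : ∀ a, 1 ≤ a → 0 ≤ H a := fun a ha => hH1 ▸ hHm.monotone ha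
  have hGc : Continuous G := continuous_iff_continuousAt.2 fun x => (hG x).continuousAt
  have hHc : Continuous H := continuous_iff_continuousAt.2 fun x => (hH x).continuousAt
  set p : ℝ → ℝ := fun t => extendLeft φ (G t) with hp
  have hp0 : ∀ t, 0 < p t := fun t => hφ.extend_pos _
  have hpm : Monotone p := hφ.extend_mono.comp hGm.monotone
  have hpc : Continuous p := hφ.extend_continuous.comp hGc
  have hpφ : ∀ t, 0 ≤ t → p t = φ (G t) := fun t ht => extendLeft_of_le (hG1 t ht)
  have hp0' : p 0 = φ 1 := by rw [hpφ 0 le_rfl, hG0]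
  have hpd : ∀ t, 0 < t → HasDerivAt p (deriv φ (G t) * p t) t := fun t ht => by
    have h1 : 1 < G t := hG0 ▸ hGm ht
    have h2 : HasDerivAt (extendLeft φ) (deriv φ (G t)) (G t) := by
      refine (hφ.diff _ h1.le).hasDerivAt.congr_of_eventuallyEq ?_
      filter_upwards [eventually_gt_nhds h1] with y hy
      exact extendLeft_of_le hy.le
    exact h2.comp t (hG t)
  have hr : ∀ n : ℕ, rate φ ε n = p (ε * n) / φ 1 := fun n => by
    have : 0 ≤ ε * n := by positivity
    rw [rate, hinv _ this, hpφ _ this]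
  have hδ : ∀ n : ℕ, deltaSeq φ ε n = ε * deriv φ (G (ε * n)) := fun n => by
    rw [deltaSeq, hinv _ (by positivity)]
  have hφ1 : 0 < φ 1 := hφ.pos 1 le_rfl
  have hratio : ∀ u v c, 0 ≤ u → u ≤ v → 0 ≤ c → p (v + c) / p v ≤ p (u + c) / p u := by
    intro u v c hu huv hc
    have hd : ∀ x, 0 < x → HasDerivAt (fun u => Real.log (p (u + c)) - Real.log (p u))
        (deriv φ (G (x + c)) - deriv φ (G x)) x := fun x hx => by
      have h1 := ((hpd (x + c) (by linarith)).comp_add_const x c).log (hp0 _).ne'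
      have h2 := (hpd x hx).log (hp0 _).ne'
      rw [mul_div_cancel_right₀ _ (hp0 _).ne'] at h1 h2
      exact h1.sub h2
    have hanti : AntitoneOn (fun u => Real.log (p (u + c)) - Real.log (p u)) (Ici 0) := by
      refine antitoneOn_of_deriv_nonpos (convex_Ici 0) ?_ ?_ ?_
      · refine Continuous.continuousOn (Continuous.sub ?_ ?_)
        · exact Continuous.log (by fun_prop) fun x => (hp0 _).ne'
        · exact Continuous.log hpc fun x => (hp0 _).ne'
      · intro x hx
        rw [interior_Ici] at hx
        exact (hd x hx).differentiableAt.differentiableWithinAt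
      · intro x hx
        rw [interior_Ici] at hx
        have hx : 0 < x := hx
        rw [(hd x hx).deriv]
        have := hφ.deriv_antitoneOn (hG1 x hx.le) (hG1 (x + c) (by linarith))
          (hGm.monotone (by linarith))
        linarith
    have := hanti (show (0:ℝ) ≤ u from hu) (show (0:ℝ) ≤ v from hu.trans huv) huv
    simp only at this
    rw [← Real.log_div (hp0 _).ne' (hp0 _).ne', ← Real.log_div (hp0 _).ne' (hp0 _).ne'] at this
    exact (Real.log_le_log_iff (div_pos (hp0 _) (hp0 _)) (div_pos (hp0 _) (hp0 _))).1 this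
  have hGstep : ∀ t, 0 ≤ t → ε * p t ≤ G (t + ε) - G t ∧ G (t + ε) - G t ≤ ε * p (t + ε) := by
    intro t ht
    have hdiff : Differentiable ℝ G := fun x => (hG x).differentiableAt
    have a1 := (convex_Icc t (t + ε)).image_sub_le_mul_sub_of_deriv_le (C := p (t + ε))
      hGc.continuousOn hdiff.differentiableOn (fun x hx => by
        rw [interior_Icc] at hx
        rw [(hG x).deriv]
        exact hpm hx.2.le) t ⟨le_rfl, by linarith⟩ (t + ε) ⟨by linarith, le_rfl⟩ (by linarith)
    have a2 := (convex_Icc t (t + ε)).mul_sub_le_image_sub_of_le_deriv (C := p t)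
      hGc.continuousOn hdiff.differentiableOn (fun x hx => by
        rw [interior_Icc] at hx
        rw [(hG x).deriv]
        exact hpm hx.1.le) t ⟨le_rfl, by linarith⟩ (t + ε) ⟨by linarith, le_rfl⟩ (by linarith)
    constructor <;> linarith
  have hsucc : ∀ n : ℕ, ε * ((n + 1 : ℕ) : ℝ) = ε * n + ε := fun n => by push_cast; ring
  have hεn : ∀ n : ℕ, 0 ≤ ε * n := fun n => by positivity
  have hhd : ∀ c x, HasDerivAt (fun w => G (H w + c) - G c)
      (p (H x + c) / extendLeft φ x) x := fun c x => by
    have h1 := ((hG (H x + c)).comp_add_const (H x) c).comp x (hH x)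
    exact h1.sub_const _
  have hsanti : ∀ c, 0 ≤ c → AntitoneOn (fun x => p (H x + c) / extendLeft φ x) (Ici 1) := by
    intro c hc a ha b hb hab
    have := hratio (H a) (H b) c (hH0 a ha) (hHm.monotone hab) hc
    simpa only [hp, hGH] using this
  have hs1 : ∀ c, p (H 1 + c) / extendLeft φ 1 = p c / φ 1 := fun c => by
    rw [hH1, zero_add, extendLeft_of_le le_rfl]
  have h_one : ∀ c, G (H 1 + c) - G c = 0 := fun c => by simp [hH1]
  refine ⟨fun n w => G (H w + ε * n) - G (ε * n),
    fun n w => p (H w + ε * n) / extendLeft φ w, ?_⟩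
  constructor
  · rw [hr]; simp [hp0', hφ1.ne']
  · intro n
    rw [hr, one_le_div hφ1, ← hp0']
    exact hpm (hεn n)
  · intro m n hmn
    simp only [hr, hsucc]
    rw [div_div_div_cancel_right₀ hφ1.ne', div_div_div_cancel_right₀ hφ1.ne']
    exact hratio _ _ _ (hεn m) (by gcongr) hε.le
  · intro n
    rw [hr, hr, hsucc]
    gcongr
    exact hpm (by linarith)
  · intro n
    rw [hr, hr, hsucc, hδ]
    have := (convex_Icc (ε * n) (ε * n + ε)).image_sub_le_mul_sub_of_deriv_le (f := p)
      (C := deriv φ (G (ε * n)) * p (ε * n + ε)) hpc.continuousOn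
      (fun x hx => by
        rw [interior_Icc] at hx
        exact (hpd x ((hεn n).trans_lt hx.1)).differentiableAt.differentiableWithinAt)
      (fun x hx => by
        rw [interior_Icc] at hx
        have hx0 : 0 ≤ x := (hεn n).trans hx.1.le
        rw [(hpd x ((hεn n).trans_lt hx.1)).deriv]
        refine mul_le_mul (hφ.deriv_antitoneOn (hG1 _ (hεn n)) (hG1 x hx0)
          (hGm.monotone hx.1.le)) (hpm hx.2.le) (hp0 _).le (hφ.deriv_nonneg (hG1 _ (hεn n))))
      (ε * n) ⟨le_rfl, by linarith⟩ (ε * n + ε) ⟨by linarith, le_rfl⟩ (by linarith)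
    rw [← sub_div, ← mul_div_assoc]
    gcongr
    linarith
  · intro n
    rw [hδ]
    exact mul_nonneg hε.le (hφ.deriv_nonneg (hG1 _ (hεn n)))
  · intro m n hmn
    rw [hδ, hδ]
    gcongr
    refine hφ.deriv_antitoneOn (hG1 _ (hεn m)) (hG1 _ (hεn n)) (hGm.monotone ?_)
    gcongr
  · simp only [funext hδ]
    have hGtop : Tendsto G atTop atTop := hGm.monotone.tendsto_atTop_atTop fun b =>
      ⟨H b, (hGH b).ge⟩
    have := (hφ.deriv_tendsto.comp (hGtop.comp
      (tendsto_natCast_atTop_atTop.const_mul_atTop hε))).const_mul ε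
    simpa using this
  · intro n
    exact (by fun_prop : Continuous fun w => G (H w + ε * n) - G (ε * n)).measurable
  · intro n
    exact h_one _
  · intro n a ha
    have : G (ε * n) ≤ G (H a + ε * n) := hGm.monotone (by linarith [hH0 a ha])
    linarith
  · intro a ha
    simp [hGH, hG0]
  · intro n a ha
    exact (div_pos (hp0 _) (hφ.extend_pos a)).le
  · intro n a ha
    rw [hr, ← hs1]
    exact hsanti _ (hεn n) (le_refl (1:ℝ)) ha ha
  · intro n a y ha hy
    exact le_tangent_of_antitoneOn (hhd _) (hsanti _ (hεn n)) ha hy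
  · intro n a ha
    have e1 : φ a = extendLeft φ a := (extendLeft_of_le ha).symm
    have e2 : ε * φ a * (p (H a + ε * ((n + 1 : ℕ) : ℝ)) / extendLeft φ a) =
        ε * p (H a + ε * n + ε) := by
      have := (hφ.extend_pos a).ne'
      rw [e1, hsucc, ← add_assoc]
      field_simp
    have e3 : ε * φ 1 * rate φ ε n = ε * p (ε * n) := by
      rw [hr]
      field_simp
    rw [e2, e3]
    simp only [hsucc]
    have g1 := (hGstep (H a + ε * n) (add_nonneg (hH0 a ha) (hεn n))).2
    have g2 := (hGstep (ε * n) (hεn n)).1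
    rw [← add_assoc]
    linarith

/-- The tails `∑ i, ∏ k < i, a (n + k + 1)` of a series with ratios `a` solve the recursion
`c n = 1 + a (n + 1) * c (n + 1)`. -/
lemma exists_tail_recursion {a : ℕ → ℝ} {l : ℝ} (ha : ∀ n, 0 < a n) (hanti : Antitone a)
    (hlim : Tendsto a atTop (nhds l)) (hl : l < 1) :
    ∃ c : ℕ → ℝ, c 0 = ∑' j, ∏ k ∈ Finset.range j, a (k + 1) ∧
      ∀ n, 0 ≤ c n ∧ c (n + 1) ≤ c n ∧ c n = 1 + a (n + 1) * c (n + 1) := by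
  have hpos : ∀ n j, 0 < ∏ k ∈ Finset.range j, a (n + k + 1) := fun n j =>
    Finset.prod_pos fun k _ => ha _
  have hsum : ∀ n, Summable fun j => ∏ k ∈ Finset.range j, a (n + k + 1) := by
    intro n
    refine summable_of_ratio_test_tendsto_lt_one hl
      (Eventually.of_forall fun j => (hpos n j).ne') ?_
    have : (fun j => ‖∏ k ∈ Finset.range (j + 1), a (n + k + 1)‖ /
        ‖∏ k ∈ Finset.range j, a (n + k + 1)‖) = fun j => a (j + (n + 1)) := by
      funext j
      rw [Real.norm_of_nonneg (hpos n _).le, Real.norm_of_nonneg (hpos n _).le,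
        Finset.prod_range_succ, mul_div_cancel_left₀ _ (hpos n j).ne']
      congr 1
      ring
    rw [this]
    exact (tendsto_add_atTop_iff_nat (n + 1)).2 hlim
  refine ⟨fun n => ∑' j, ∏ k ∈ Finset.range j, a (n + k + 1), by simp, fun n => ⟨?_, ?_, ?_⟩⟩
  · exact tsum_nonneg fun j => (hpos n j).le
  · refine Summable.tsum_le_tsum (fun j => ?_) (hsum _) (hsum _)
    exact Finset.prod_le_prod (fun k _ => (ha _).le) fun k _ => hanti (by lia)
  · simp only
    rw [(hsum n).tsum_eq_zero_add, Finset.prod_range_zero, ← tsum_mul_left]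
    congr 1
    refine tsum_congr fun j => ?_
    rw [Finset.prod_range_succ', mul_comm]
    congr 1
    exact Finset.prod_congr rfl fun k _ => congrArg a (by ring)

section Coupling

variable {X : Type*} [MeasurableSpace X]

open Classical in
/-- The mass `ε ν` which is coupled in one step from the pairs in `C × C`. -/
noncomputable def coupledPart {C : Set X} (hC : MeasurableSet C) (ν : Measure X) (ε : ℝ) :
    Kernel (X × X) X :=
  Kernel.piecewise (hC.prod hC) (Kernel.const _ (ENNReal.ofReal ε • ν)) 0

open Classical in
/-- The part of a Markov kernel on `C` left after subtracting the minorizing measure. -/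
noncomputable def residualKernel (κ : Kernel X X) [IsMarkovKernel κ] {C : Set X}
    (hC : MeasurableSet C) (ν : Measure X) [IsProbabilityMeasure ν] (ε : ℝ)
    (h : ∀ x ∈ C, ENNReal.ofReal ε • ν ≤ κ x) : Kernel X X where
  toFun x := if x ∈ C then κ x - ENNReal.ofReal ε • ν else 0
  measurable' := by
    refine Measure.measurable_of_measurable_coe _ fun A hA => ?_
    have hfin : IsFiniteMeasure (ENNReal.ofReal ε • ν) :=
      Measure.smul_finite _ ENNReal.ofReal_ne_top
    have : (fun x => (if x ∈ C then κ x - ENNReal.ofReal ε • ν else 0 : Measure X) A) =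
        fun x => if x ∈ C then κ x A - ENNReal.ofReal ε * ν A else 0 := by
      funext x
      split_ifs with hx
      · rw [Measure.sub_apply hA (h x hx)]; rfl
      · rfl
    rw [this]
    exact Measurable.ite hC ((κ.measurable_coe hA).sub measurable_const) measurable_const

/-- A minorization condition yields a sub-Markov kernel on pairs describing two chains that have
not been coupled yet. -/
lemma exists_uncoupled_kernel (κ : Kernel X X) [IsMarkovKernel κ] {C : Set X}
    (hC : MeasurableSet C) (ν : Measure X) [IsProbabilityMeasure ν] {ε : ℝ}
    (hε : ε ∈ Ioo (0 : ℝ) 1) (h : ∀ x ∈ C, ENNReal.ofReal ε • ν ≤ κ x) :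
    ∃ K : Kernel (X × X) (X × X), ∀ z,
      (K z).map Prod.fst + coupledPart hC ν ε z = κ z.1 ∧
      (K z).map Prod.snd + coupledPart hC ν ε z = κ z.2 := by
  classical
  have hfin : IsFiniteMeasure (ENNReal.ofReal ε • ν) :=
    Measure.smul_finite _ ENNReal.ofReal_ne_top
  set R := residualKernel κ hC ν ε h with hR
  have hRx : ∀ x ∈ C, R x + ENNReal.ofReal ε • ν = κ x := fun x hx => by
    have : R x = κ x - ENNReal.ofReal ε • ν := if_pos hx
    rw [this, Measure.sub_add_cancel_of_le (h x hx)]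
  have hRle : ∀ x, R x ≤ κ x := fun x => by
    by_cases hx : x ∈ C
    · rw [← hRx x hx]; exact Measure.le_add_right le_rfl
    · have : R x = 0 := if_neg hx
      rw [this]; exact Measure.zero_le _
  have hRfin : IsFiniteKernel R := ⟨1, ENNReal.one_lt_top, fun x => by
    simpa using hRle x univ⟩
  have hmass : ∀ x ∈ C, R x univ = ENNReal.ofReal (1 - ε) := fun x hx => by
    have h1 := congrArg (fun μ : Measure X => μ univ) (hRx x hx)
    simp only [Measure.coe_add, Pi.add_apply, Measure.smul_apply, measure_univ, smul_eq_mul,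
      mul_one] at h1
    rw [ENNReal.ofReal_sub _ hε.1.le, ENNReal.ofReal_one, ← h1,
      ENNReal.add_sub_cancel_right ENNReal.ofReal_ne_top]
  have h0 : ENNReal.ofReal (1 - ε) ≠ 0 := by simpa using hε.2
  have hcancel : ∀ μ : Measure X, (ENNReal.ofReal (1 - ε))⁻¹ • ENNReal.ofReal (1 - ε) • μ = μ :=
    fun μ => by rw [smul_smul, ENNReal.inv_mul_cancel h0 ENNReal.ofReal_ne_top, one_smul]
  have hscale : Measurable fun z => (ENNReal.ofReal (1 - ε))⁻¹ • (R ∥ₖ R) z := by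
    refine Measure.measurable_of_measurable_coe _ fun A hA => ?_
    simp only [Measure.smul_apply, smul_eq_mul]
    exact ((R ∥ₖ R).measurable_coe hA).const_mul _
  refine ⟨Kernel.piecewise (hC.prod hC) ⟨fun z => (ENNReal.ofReal (1 - ε))⁻¹ • (R ∥ₖ R) z, hscale⟩
    (κ ∥ₖ κ), fun z => ?_⟩
  by_cases hz : z ∈ C ×ˢ C
  · simp only [coupledPart, Kernel.piecewise_apply, if_pos hz, Kernel.const_apply,
      Kernel.coe_mk, Kernel.parallelComp_apply, Measure.map_smul, Measure.map_fst_prod,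
      Measure.map_snd_prod, hmass _ hz.1, hmass _ hz.2, hcancel, hRx _ hz.1, hRx _ hz.2, and_self]
  · simp only [coupledPart, Kernel.piecewise_apply, if_neg hz, Kernel.parallelComp_apply,
      Measure.map_fst_prod, Measure.map_snd_prod, measure_univ, one_smul, zero_apply,
      add_zero, and_self]

/-- Splitting off a finite part from a probability measure, for a function bounded below by
one. -/
lemma integral_add_le_of_add_eq {μ J η : Measure X} [IsProbabilityMeasure η] (h : μ + J = η)
    {V : X → ℝ} (hV1 : ∀ x, 1 ≤ V x) (hV : Integrable V η) :
    IsFiniteMeasure μ ∧ Integrable V μ ∧ μ.real univ + J.real univ = 1 ∧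
      ∫ x, V x ∂μ + J.real univ ≤ ∫ x, V x ∂η := by
  have hle : J ≤ η := h ▸ Measure.le_add_left le_rfl
  have hle' : μ ≤ η := h ▸ Measure.le_add_right le_rfl
  have hJ : IsFiniteMeasure J := isFiniteMeasure_of_le η hle
  have hμ : IsFiniteMeasure μ := isFiniteMeasure_of_le η hle'
  refine ⟨hμ, hV.mono_measure hle', ?_, ?_⟩
  · rw [← measureReal_add_apply, h, probReal_univ]
  · rw [← h, integral_add_measure (hV.mono_measure hle') (hV.mono_measure hle)]
    have : ∫ _, (1:ℝ) ∂J ≤ ∫ x, V x ∂J :=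
      integral_mono (integrable_const _) (hV.mono_measure hle) hV1
    simp only [integral_const, smul_eq_mul, mul_one] at this
    linarith

end Coupling

lemma visit_step_outside {k c c' ρ ρ' r₀ η a : ℝ} (hk : 0 < k) (hc' : 0 ≤ c') (hc : c' ≤ c)
    (hρ' : 1 ≤ ρ') (hρ : ρ' ≤ ρ) (hr : 1 ≤ r₀) (hη : 0 ≤ η) (hηa : k * η ≤ k * a - r₀) :
    c' * (ρ' * (ρ * r₀) + ρ' * (ρ' - 1) * k * η) ≤ c * (ρ * r₀ + ρ * (ρ - 1) * k * a) := by
  have hkη : 0 ≤ k * η := by positivity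
  have h1 : (ρ' - 1) * (k * η) ≤ (ρ - 1) * (k * a - r₀) :=
    mul_le_mul (by linarith) hηa hkη (by linarith)
  have h2 : ρ' * (ρ * r₀ + (ρ' - 1) * (k * η)) ≤ ρ * (ρ * r₀ + (ρ - 1) * (k * a - r₀)) := by
    refine mul_le_mul hρ (by linarith) ?_ (by linarith)
    have : 0 ≤ (ρ' - 1) * (k * η) := mul_nonneg (by linarith) hkη
    have : 0 ≤ ρ * r₀ := mul_nonneg (by linarith) (by linarith)
    linarith
  have h3 : ρ * (ρ * r₀ + (ρ - 1) * (k * a - r₀)) = ρ * r₀ + ρ * (ρ - 1) * k * a := by ring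
  have h4 : ρ' * (ρ * r₀ + (ρ' - 1) * (k * η)) = ρ' * (ρ * r₀) + ρ' * (ρ' - 1) * k * η := by ring
  rw [h3, h4] at h2
  refine mul_le_mul hc h2 ?_ (by linarith)
  have : 0 ≤ ρ' * (ρ' - 1) * (k * η) :=
    mul_nonneg (mul_nonneg (by linarith) (by linarith)) hkη
  have : 0 ≤ ρ' * (ρ * r₀) := mul_nonneg (by linarith) (mul_nonneg (by linarith) (by linarith))
  linarith

lemma visit_step_inside {k c c' R δ q ε ρ' r₁ η : ℝ} (hk : 0 < k) (hc' : 0 ≤ c')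
    (hρ' : 1 ≤ ρ') (hρR : ρ' ≤ R) (hδ : 0 ≤ δ) (hρδ : ρ' - 1 ≤ δ * ρ') (hr : 1 ≤ r₁)
    (hq : 0 ≤ q) (hε : ε ≤ 1) (hη : η ≤ r₁ * ((1 - ε) * (2 * q)))
    (hc : c = 1 + (1 - ε) * (1 + δ * (R * (1 + 2 * R * k * q))) * c') :
    c' * ((1 - ε) * (ρ' * r₁) + ρ' * (ρ' - 1) * k * η) + r₁ ≤ c * r₁ := by
  have h1 : ρ' - 1 ≤ δ * R := hρδ.trans (by gcongr)
  have h2 : ρ' * (ρ' - 1) ≤ R * (δ * R) := mul_le_mul hρR h1 (by linarith) (by linarith)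
  have h3 : ρ' * (ρ' - 1) * k * η ≤ ρ' * (ρ' - 1) * k * (r₁ * ((1 - ε) * (2 * q))) := by
    refine mul_le_mul_of_nonneg_left hη ?_
    exact mul_nonneg (mul_nonneg (by linarith) (by linarith)) hk.le
  have h4 : ρ' * (ρ' - 1) * (k * (r₁ * ((1 - ε) * (2 * q)))) ≤
      R * (δ * R) * (k * (r₁ * ((1 - ε) * (2 * q)))) := by
    refine mul_le_mul_of_nonneg_right h2 ?_
    have : 0 ≤ 1 - ε := by linarith
    positivity
  have h5 : (1 - ε) * (ρ' * r₁) ≤ (1 - ε) * ((1 + δ * R) * r₁) := by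
    refine mul_le_mul_of_nonneg_left ?_ (by linarith)
    exact mul_le_mul_of_nonneg_right (by linarith) (by linarith)
  have h6 : (1 - ε) * (ρ' * r₁) + ρ' * (ρ' - 1) * k * η ≤
      (1 - ε) * (1 + δ * (R * (1 + 2 * R * k * q))) * r₁ := by
    have e : (1 - ε) * (1 + δ * (R * (1 + 2 * R * k * q))) * r₁ =
      (1 - ε) * ((1 + δ * R) * r₁) + R * (δ * R) * (k * (r₁ * ((1 - ε) * (2 * q)))) := by ring
    rw [e]
    linarith
  have h7 := mul_le_mul_of_nonneg_left h6 hc'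
  rw [hc]
  linarith

lemma descent_inside {k b φ₁ ε εν η η' r₀ r₁ S w w' x y : ℝ} (hk : 0 < k) (hφ : 0 < φ₁)
    (hkε : k * (ε * φ₁) = 1) (hb : 0 ≤ b) (hεν : 0 < εν)
    (hη : η ≤ η' - ε * φ₁ * r₀ + 2 * b * r₁) (hx : x + r₁ ≤ y)
    (hw : w' ≤ w - ε * S + 2 * b) :
    k * (2 * η + 4 * b * x + w' + (1 - εν) * (2 * b / εν)) + (2 * r₀ + S / φ₁) ≤
      k * (2 * η' + 4 * b * y + w + 2 * b / εν) := by
  have e4 : (1 - εν) * (2 * b / εν) = 2 * b / εν - 2 * b := by field_simp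
  have e6 : S / φ₁ = k * (ε * S) := by
    rw [div_eq_iff hφ.ne']; linear_combination (-S) * hkε
  rw [e4, e6]
  have f1 := mul_le_mul_of_nonneg_left hη hk.le
  have f2 := mul_le_mul_of_nonneg_left hx (show 0 ≤ k * (4 * b) by positivity)
  have f3 := mul_le_mul_of_nonneg_left hw hk.le
  linear_combination 2 * f1 + f2 + f3 - 2 * r₀ * hkε

lemma descent_outside {k b φ₁ ε B η η' r₀ S w w' x y : ℝ} (hk : 0 < k) (hφ : 0 < φ₁)
    (hkε : k * (ε * φ₁) = 1) (hb : 0 ≤ b) (hη : η ≤ η' - ε * φ₁ * r₀) (hx : x ≤ y)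
    (hw : w' ≤ w - ε * S) :
    k * (2 * η + 4 * b * x + w' + B) + (2 * r₀ + S / φ₁) ≤
      k * (2 * η' + 4 * b * y + w + B) := by
  have e6 : S / φ₁ = k * (ε * S) := by
    rw [div_eq_iff hφ.ne']; linear_combination (-S) * hkε
  rw [e6]
  have f1 := mul_le_mul_of_nonneg_left hη hk.le
  have f2 := mul_le_mul_of_nonneg_left hx (show 0 ≤ k * (4 * b) by positivity)
  have f3 := mul_le_mul_of_nonneg_left hw hk.le
  linear_combination 2 * f1 + f2 + f3 - 2 * r₀ * hkε

section Lyapunov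

variable {X : Type*} [MeasurableSpace X]

open Classical in
/-- The time-dependent Lyapunov function controlling the uncoupled pair. -/
noncomputable def pairLyapunov (C : Set X) (V : X → ℝ) (k b εν : ℝ) (r c : ℕ → ℝ) (h : ℕ → ℝ → ℝ)
    (n : ℕ) (z : X × X) : ℝ :=
  k * (2 * h n (V z.1 + V z.2 - 1) +
    4 * b * (c n * (r (n + 1) + if z ∈ C ×ˢ C then 0 else
      r (n + 1) / r n * (r (n + 1) / r n - 1) * k * h n (V z.1 + V z.2 - 1))) +
    (V z.1 + V z.2 - 1) + 2 * b / εν)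

variable {C : Set X} {V : X → ℝ} {k b εν : ℝ} {r c : ℕ → ℝ} {h : ℕ → ℝ → ℝ}

lemma measurable_pairLyapunov (hC : MeasurableSet C) (hV : Measurable V)
    (hh : ∀ n, Measurable (h n)) (n : ℕ) : Measurable (pairLyapunov C V k b εν r c h n) := by
  have hW : Measurable fun z : X × X => V z.1 + V z.2 - 1 := by fun_prop
  have hhW := (hh n).comp hW
  refine Measurable.const_mul (((Measurable.const_mul hhW 2).add (Measurable.const_mul
    (Measurable.const_mul (measurable_const.add (Measurable.ite (hC.prod hC) measurable_const
      (hhW.const_mul _))) _) _)).add hW |>.add measurable_const) _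

lemma coupledPart_real_univ (hC : MeasurableSet C) (ν : Measure X) [IsProbabilityMeasure ν]
    (hε : 0 ≤ εν) (z : X × X) [Decidable (z ∈ C ×ˢ C)] :
    (coupledPart hC ν εν z).real univ = if z ∈ C ×ˢ C then εν else 0 := by
  by_cases hz : z ∈ C ×ˢ C
  · simp [coupledPart, Kernel.piecewise_apply, hz, hε]
  · simp [coupledPart, Kernel.piecewise_apply, hz]

set_option maxHeartbeats 400000 in
/-- One step of the Lyapunov descent for the uncoupled pair. -/
lemma pairLyapunov_descent {φ : ℝ → ℝ} {ε q cV : ℝ} {δ : ℕ → ℝ} {s : ℕ → ℝ → ℝ}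
    (hφ : IsDriftFunction φ) (hfam : RateFamily φ ε r δ h s)
    (hC : MeasurableSet C) (hV1 : ∀ x, 1 ≤ V x) (hVm : Measurable V)
    (hε : ε ∈ Ioo (0 : ℝ) 1) (hεν : εν ∈ Ioo (0 : ℝ) 1) (hb : 0 ≤ b) (hq : 0 ≤ q)
    (hqeq : (1 - εν) * (q + 1) = b + cV) (hk : k = (ε * φ 1)⁻¹)
    (hout : ∀ x ∉ C, b / (1 - ε) ≤ φ (V x)) (hin : ∀ x ∈ C, V x ≤ cV)
    (hc : ∀ n, 0 ≤ c n ∧ c (n + 1) ≤ c n ∧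
      c n = 1 + (1 - εν) * (1 + δ (n + 1) * (r 1 * (1 + 2 * r 1 * k * q))) * c (n + 1))
    (κ : Kernel X X) [IsMarkovKernel κ] (ν : Measure X) [IsProbabilityMeasure ν]
    (hVint : ∀ x, Integrable V (κ x))
    (hdrift : ∀ x, ∫ y, V y ∂(κ x) ≤ V x - φ (V x) + b * C.indicator 1 x)
    (K : Kernel (X × X) (X × X))
    (hK : ∀ z, (K z).map Prod.fst + coupledPart hC ν εν z = κ z.1 ∧
      (K z).map Prod.snd + coupledPart hC ν εν z = κ z.2) (n : ℕ) (z : X × X) :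
    ∫⁻ y, ENNReal.ofReal (pairLyapunov C V k b εν r c h (n + 1) y) ∂(K z) +
      ENNReal.ofReal (2 * r n + (φ (V z.1) + φ (V z.2)) / φ 1) ≤
    ENNReal.ofReal (pairLyapunov C V k b εν r c h n z) := by
  classical
  set W : X × X → ℝ := fun z => V z.1 + V z.2 - 1 with hWdef
  have hW1 : ∀ z, 1 ≤ W z := fun z => by
    have := hV1 z.1; have := hV1 z.2; simp only [hWdef]; linarith
  have hWm : Measurable W := by fun_prop
  have hφ1 : 0 < φ 1 := hφ.pos 1 le_rfl
  have hk0 : 0 < k := by rw [hk]; exact inv_pos.2 (mul_pos hε.1 hφ1)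
  have hkε : k * (ε * φ 1) = 1 := by rw [hk]; exact inv_mul_cancel₀ (mul_pos hε.1 hφ1).ne'
  have hr0 : ∀ n, 0 < r n := fun n => one_pos.trans_le (hfam.one_le_rate n)
  -- marginal computations under `K z`
  obtain ⟨hfin1, hi1, hm1, hv1⟩ := integral_add_le_of_add_eq (hK z).1 hV1 (hVint z.1)
  obtain ⟨-, hi2, -, hv2⟩ := integral_add_le_of_add_eq (hK z).2 hV1 (hVint z.2)
  rw [coupledPart_real_univ hC ν hεν.1.le z] at hm1 hv1 hv2
  have hmass : ((K z).map Prod.fst).real univ = (K z).real univ := by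
    rw [map_measureReal_apply measurable_fst MeasurableSet.univ, preimage_univ]
  have hKfin : IsFiniteMeasure (K z) := ⟨by
    have := hfin1.measure_univ_lt_top
    rwa [Measure.map_apply measurable_fst MeasurableSet.univ, preimage_univ] at this⟩
  rw [hmass] at hm1
  rw [integral_map measurable_fst.aemeasurable hVm.aestronglyMeasurable] at hv1
  rw [integral_map measurable_snd.aemeasurable hVm.aestronglyMeasurable] at hv2
  replace hi1 : Integrable (fun y : X × X => V y.1) (K z) := hi1.comp_measurable measurable_fst
  replace hi2 : Integrable (fun y : X × X => V y.2) (K z) := hi2.comp_measurable measurable_snd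
  have hWi : Integrable W (K z) := (hi1.add hi2).sub (integrable_const 1)
  have hWint : ∫ y, W y ∂(K z) = ∫ y, V y.1 ∂(K z) + ∫ y, V y.2 ∂(K z) - (K z).real univ := by
    have e : ∫ y, W y ∂(K z) = ∫ y, (V y.1 + V y.2) ∂(K z) - ∫ _, (1:ℝ) ∂(K z) :=
      integral_sub (hi1.add hi2) (integrable_const 1)
    rw [e, integral_add hi1 hi2]
    simp
  set m := (K z).real univ with hm
  set w' := ∫ y, W y ∂(K z) with hw'
  have hhm : Measurable fun y => h (n + 1) (W y) := (hfam.measurable _).comp hWm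
  have hhle : ∀ y, h (n + 1) (W y) ≤ r (n + 1) * (W y - 1) := fun y => by
    have h1 := hfam.le_tangent (n + 1) 1 (W y) le_rfl (hW1 y)
    rw [hfam.at_one, zero_add] at h1
    refine h1.trans (mul_le_mul_of_nonneg_right (hfam.slope_le _ _ le_rfl) ?_)
    linarith [hW1 y]
  have hh0 : ∀ n y, 0 ≤ h n (W y) := fun n y => hfam.nonneg _ _ (hW1 y)
  have hhi : Integrable (fun y => h (n + 1) (W y)) (K z) := by
    refine Integrable.mono' ((hWi.sub (integrable_const 1)).const_mul (r (n + 1)))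
      hhm.aestronglyMeasurable (Eventually.of_forall fun y => ?_)
    rw [Real.norm_of_nonneg (hh0 _ y)]
    exact hhle y
  set η := ∫ y, h (n + 1) (W y) ∂(K z) with hη
  have hη0 : 0 ≤ η := integral_nonneg fun y => hh0 _ y
  have hη1 : η ≤ r (n + 1) * (w' - m) := by
    have := integral_mono hhi ((hWi.sub (integrable_const 1)).const_mul (r (n + 1))) hhle
    rw [integral_const_mul] at this
    have e : ∫ y, (W y - 1) ∂(K z) = w' - m := by
      rw [integral_sub hWi (integrable_const (1:ℝ))]
      simp [← hw', ← hm]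
    exact this.trans_eq (congrArg _ e)
  have hηt : η ≤ m * (h (n + 1) (W z) - s (n + 1) (W z) * W z) + s (n + 1) (W z) * w' := by
    have hi : Integrable (fun y => (h (n + 1) (W z) - s (n + 1) (W z) * W z) +
        s (n + 1) (W z) * W y) (K z) := (integrable_const _).add (hWi.const_mul _)
    have := integral_mono hhi hi fun y => by
      have := hfam.le_tangent (n + 1) (W z) (W y) (hW1 z) (hW1 y)
      simp only
      linarith
    rw [integral_add (integrable_const _) (hWi.const_mul _), integral_const_mul] at this
    simpa using this
  -- an affine majorant of the Lyapunov function
  set ρ' := r (n + 1 + 1) / r (n + 1) with hρ'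
  set ρ := r (n + 1) / r n with hρ
  have hρ'1 : 1 ≤ ρ' := (one_le_div (hr0 _)).2 (hfam.rate_mono _)
  have hρ1 : 1 ≤ ρ := (one_le_div (hr0 _)).2 (hfam.rate_mono _)
  have hρρ : ρ' ≤ ρ := hfam.ratio_le n (n + 1) n.le_succ
  have hρR : ρ' ≤ r 1 := by
    have := hfam.ratio_le 0 (n + 1) (Nat.zero_le _)
    rwa [hfam.rate_zero, div_one] at this
  have hr1 : r (n + 1) = ρ * r n := by rw [hρ, div_mul_cancel₀ _ (hr0 _).ne']
  have hr2 : r (n + 1 + 1) = ρ' * r (n + 1) := by rw [hρ', div_mul_cancel₀ _ (hr0 _).ne']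
  have hρδ : ρ' - 1 ≤ δ (n + 1) * ρ' := by
    have := hfam.rate_sub_le (n + 1)
    rw [hr2] at this
    have h2 : (ρ' - 1) * r (n + 1) ≤ (δ (n + 1) * ρ') * r (n + 1) := by linarith
    exact le_of_mul_le_mul_right h2 (hr0 _)
  obtain ⟨hc0, hcc, hcrec⟩ := hc n
  have hc'0 := (hc (n + 1)).1
  set c' := c (n + 1) with hc'
  set A : ℝ := ρ' * (ρ' - 1) * k with hA
  have hA0 : 0 ≤ A := mul_nonneg (mul_nonneg (by linarith) (by linarith)) hk0.le
  set F : X × X → ℝ := fun y => k * (2 * h (n + 1) (W y) +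
    4 * b * (c' * (ρ' * r (n + 1) + A * h (n + 1) (W y))) + W y + 2 * b / εν) with hF
  have hGF : ∀ y, pairLyapunov C V k b εν r c h (n + 1) y ≤ F y := fun y => by
    simp only [pairLyapunov, hF]
    rw [← hρ', ← hA, ← hr2]
    have : (if y ∈ C ×ˢ C then 0 else A * h (n + 1) (V y.1 + V y.2 - 1)) ≤
        A * h (n + 1) (W y) := by
      split_ifs
      · exact mul_nonneg hA0 (hh0 _ y)
      · exact le_rfl
    gcongr
  have hF0 : ∀ y, 0 ≤ F y := fun y => by
    have := hh0 (n + 1) y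
    have := hW1 y
    have := hr0 (n + 1)
    have := hεν.1
    simp only [hF]
    positivity
  have hFeq : F = fun y => (k * (2 + 4 * b * c' * A)) * h (n + 1) (W y) + k * W y +
      k * (4 * b * c' * (ρ' * r (n + 1)) + 2 * b / εν) := by
    funext y; simp only [hF]; ring
  have hFi : Integrable F (K z) := by
    rw [hFeq]
    exact ((hhi.const_mul _).add (hWi.const_mul _)).add (integrable_const _)
  have hFint : ∫ y, F y ∂(K z) = k * (2 * η +
      4 * b * (c' * (m * (ρ' * r (n + 1)) + A * η)) + w' + m * (2 * b / εν)) := by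
    have i1 := hhi.const_mul (k * (2 + 4 * b * c' * A))
    have i2 := hWi.const_mul k
    have i3 : Integrable (fun y => k * (2 + 4 * b * c' * A) * h (n + 1) (W y) + k * W y) (K z) :=
      i1.add i2
    rw [hFeq, integral_add i3 (integrable_const _), integral_add i1 i2, integral_const_mul,
      integral_const_mul, integral_const, smul_eq_mul, ← hη, ← hw', ← hm]
    ring
  have hg0 : 0 ≤ 2 * r n + (φ (V z.1) + φ (V z.2)) / φ 1 := by
    have := hr0 n
    have := hφ.pos _ (hV1 z.1)
    have := hφ.pos _ (hV1 z.2)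
    positivity
  suffices hmain : ∫ y, F y ∂(K z) + (2 * r n + (φ (V z.1) + φ (V z.2)) / φ 1) ≤
      pairLyapunov C V k b εν r c h n z by
    calc _ ≤ ∫⁻ y, ENNReal.ofReal (F y) ∂(K z) +
        ENNReal.ofReal (2 * r n + (φ (V z.1) + φ (V z.2)) / φ 1) := by
          gcongr with y
          exact hGF y
      _ = ENNReal.ofReal (∫ y, F y ∂(K z) + (2 * r n + (φ (V z.1) + φ (V z.2)) / φ 1)) := by
          rw [ENNReal.ofReal_add (integral_nonneg hF0) hg0,
            ofReal_integral_eq_lintegral_ofReal hFi (Eventually.of_forall hF0)]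
      _ ≤ _ := ENNReal.ofReal_le_ofReal hmain
  rw [hFint]
  have hd1 := hdrift z.1
  have hd2 := hdrift z.2
  have hsub := hφ.subadd (hV1 z.1) (hV1 z.2)
  have hφ1' := hφ.pos _ (hV1 z.1)
  have hφ2' := hφ.pos _ (hV1 z.2)
  have hs0 := hfam.slope_nonneg (n + 1) (W z) (hW1 z)
  have hdesc := hfam.descent n (W z) (hW1 z)
  have hε1 : 0 < 1 - ε := by linarith [hε.2]
  have hrn := hfam.one_le_rate n
  by_cases hz : z ∈ C ×ˢ C
  · simp only [if_pos hz] at hm1 hv1 hv2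
    have hm' : m = 1 - εν := by linarith
    rw [indicator_of_mem hz.1] at hd1
    rw [indicator_of_mem hz.2] at hd2
    simp only [Pi.one_apply, mul_one] at hd1 hd2
    have hwr : w' ≤ W z - (φ (V z.1) + φ (V z.2)) + 2 * b - εν := by
      simp only [hWdef]; linarith
    have hη2 : η ≤ r (n + 1) * ((1 - εν) * (2 * q)) := by
      refine hη1.trans (mul_le_mul_of_nonneg_left ?_ (hr0 _).le)
      have := hin _ hz.1
      have := hin _ hz.2
      have e : (1 - εν) * (2 * q) = 2 * (b + cV) - 2 * (1 - εν) := by rw [← hqeq]; ring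
      rw [e]
      linarith [hεν.1]
    have hvis := visit_step_inside hk0 hc'0 hρ'1 hρR (hfam.delta_nonneg (n + 1)) hρδ
      (hfam.one_le_rate _) hq hεν.2.le hη2 hcrec
    have htan := hfam.le_tangent (n + 1) (W z) 1 (hW1 z) le_rfl
    rw [hfam.at_one] at htan
    have hεφ : ε * (φ (V z.1) + φ (V z.2)) ≤ φ (V z.1) + φ (V z.2) :=
      mul_le_of_le_one_left (by positivity) hε.2.le
    have hη3 : η ≤ h n (W z) - ε * φ 1 * r n + 2 * b * r (n + 1) := by
      have e1 : s (n + 1) (W z) * w' ≤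
          s (n + 1) (W z) * (W z - ε * φ (W z) + 2 * b - εν) := by
        refine mul_le_mul_of_nonneg_left ?_ hs0
        have : ε * φ (W z) ≤ ε * (φ (V z.1) + φ (V z.2)) :=
          mul_le_mul_of_nonneg_left (by simp only [hWdef]; linarith) hε.1.le
        linear_combination hwr + hεφ + this
      have e2 : s (n + 1) (W z) * (2 * b) ≤ r (n + 1) * (2 * b) :=
        mul_le_mul_of_nonneg_right (hfam.slope_le _ _ (hW1 z)) (by linarith)
      have e3 : 0 ≤ εν * (h (n + 1) (W z) + s (n + 1) (W z) * (1 - W z)) :=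
        mul_nonneg hεν.1.le htan
      rw [hm'] at hηt
      have e4 : 0 ≤ s (n + 1) (W z) * εν := mul_nonneg hs0 hεν.1.le
      linear_combination hηt + e1 + e2 + e3 + hdesc
    simp only [pairLyapunov, if_pos hz, add_zero]
    have hW' : V z.1 + V z.2 - 1 = W z := rfl
    rw [hW', hm']
    exact descent_inside hk0 hφ1 hkε hb hεν.1 hη3 hvis (by linarith [hεν.1])
  · simp only [if_neg hz] at hm1 hv1 hv2
    have hm' : m = 1 := by linarith
    have hb1 : ∀ x ∉ C, b ≤ (1 - ε) * φ (V x) := fun x hx => by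
      have := (div_le_iff₀ hε1).1 (hout x hx)
      linarith
    have hwr : w' ≤ W z - ε * (φ (V z.1) + φ (V z.2)) := by
      have e : W z = V z.1 + V z.2 - 1 := rfl
      have f1 : ε * φ (V z.1) ≤ φ (V z.1) :=
        mul_le_of_le_one_left hφ1'.le hε.2.le
      have f2 : ε * φ (V z.2) ≤ φ (V z.2) :=
        mul_le_of_le_one_left hφ2'.le hε.2.le
      by_cases h1 : z.1 ∈ C
      · have h2 : z.2 ∉ C := fun h2 => hz ⟨h1, h2⟩
        rw [indicator_of_mem h1, Pi.one_apply] at hd1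
        rw [indicator_of_notMem h2] at hd2
        have := hb1 _ h2
        linarith
      · rw [indicator_of_notMem h1] at hd1
        have := hb1 _ h1
        have : b * C.indicator 1 z.2 ≤ b := by
          by_cases h2 : z.2 ∈ C
          · simp [h2]
          · simp [h2, hb]
        linarith
    have hη3 : η ≤ h n (W z) - ε * φ 1 * r n := by
      have e1 : s (n + 1) (W z) * w' ≤ s (n + 1) (W z) * (W z - ε * φ (W z)) := by
        refine mul_le_mul_of_nonneg_left ?_ hs0
        have : ε * φ (W z) ≤ ε * (φ (V z.1) + φ (V z.2)) :=
          mul_le_mul_of_nonneg_left (by simp only [hWdef]; linarith) hε.1.le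
        linear_combination hwr + this
      rw [hm'] at hηt
      linear_combination hηt + e1 + hdesc
    have f1 := mul_le_mul_of_nonneg_left hη3 hk0.le
    have hvis := visit_step_outside (a := h n (W z)) hk0 hc'0 hcc hρ'1 hρρ hrn hη0
      (by linear_combination f1 - r n * hkε)
    rw [← hr1, ← hA] at hvis
    simp only [pairLyapunov, if_neg hz]
    have hW' : V z.1 + V z.2 - 1 = W z := rfl
    rw [hW', hm', one_mul, one_mul]
    exact descent_outside hk0 hφ1 hkε hb hη3 hvis hwr

end Lyapunov

section Marginals

variable {X : Type*} [MeasurableSpace X]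

instance isMarkovKernel_iterKernel (P : ℕ → Kernel X X) [∀ k, IsMarkovKernel (P k)] (n : ℕ) :
    IsMarkovKernel (iterKernel P n) := by
  induction n with
  | zero => exact inferInstanceAs (IsMarkovKernel Kernel.id)
  | succ n ih => exact inferInstanceAs (IsMarkovKernel ((P (n + 1)).comp (iterKernel P n)))

lemma iterKernel_succ_comp (P : ℕ → Kernel X X) (n : ℕ) (μ : Measure X) :
    iterKernel P (n + 1) ∘ₘ μ = P (n + 1) ∘ₘ (iterKernel P n ∘ₘ μ) :=
  Measure.comp_assoc.symm

lemma integral_comp_measure {κ : Kernel X X} {μ : Measure X} [IsProbabilityMeasure μ]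
    [IsMarkovKernel κ] {f : X → ℝ} (hf : Integrable f (κ ∘ₘ μ)) :
    ∫ x, ∫ y, f y ∂(κ x) ∂μ = ∫ y, f y ∂(κ ∘ₘ μ) := by
  have h : (κ ∘ₖ Kernel.const Unit μ) () = κ ∘ₘ μ := by simp
  have := Kernel.integral_comp (η := κ) (κ := Kernel.const Unit μ) (a := ()) (f := f)
    (by rwa [h])
  rw [h] at this
  simpa using this.symm

/-- Integrability and growth of a function along one step of a Markov kernel. -/
lemma integrable_comp_of_integral_le {κ : Kernel X X} [IsMarkovKernel κ] {μ : Measure X}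
    [IsProbabilityMeasure μ] {V : X → ℝ} (hV : Measurable V) (hV1 : ∀ x, 1 ≤ V x)
    (hVμ : Integrable V μ) (hVκ : ∀ x, Integrable V (κ x)) {b : ℝ}
    (hb : ∀ x, ∫ y, V y ∂(κ x) ≤ V x + b) :
    Integrable V (κ ∘ₘ μ) ∧ ∫ y, V y ∂(κ ∘ₘ μ) ≤ ∫ x, V x ∂μ + b := by
  have hn : ∀ x, ∫ y, ‖V y‖ ∂(κ x) = ∫ y, V y ∂(κ x) := fun x =>
    integral_congr_ae (Eventually.of_forall fun y =>
      Real.norm_of_nonneg (zero_le_one.trans (hV1 y)))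
  have hi : Integrable (fun x => ∫ y, V y ∂(κ x)) μ := by
    refine Integrable.mono' (hVμ.add (integrable_const b))
      hV.stronglyMeasurable.integral_kernel.aestronglyMeasurable
      (Eventually.of_forall fun x => ?_)
    rw [Real.norm_of_nonneg (integral_nonneg fun y => zero_le_one.trans (hV1 y))]
    exact hb x
  have hint : Integrable V (κ ∘ₘ μ) := by
    rw [Measure.integrable_comp_iff hV.aestronglyMeasurable]
    exact ⟨Eventually.of_forall hVκ, by simpa only [hn] using hi⟩
  refine ⟨hint, ?_⟩
  rw [← integral_comp_measure hint]
  refine (integral_mono hi (hVμ.add (integrable_const b)) hb).trans_eq ?_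
  simp only [Pi.add_apply]
  rw [integral_add hVμ (integrable_const b)]
  simp

lemma integrable_iterKernel (P : ℕ → Kernel X X) [∀ k, IsMarkovKernel (P k)] {μ : Measure X}
    [IsProbabilityMeasure μ] {V : X → ℝ} (hV : Measurable V) (hV1 : ∀ x, 1 ≤ V x)
    (hVμ : Integrable V μ) (hVP : ∀ k, 1 ≤ k → ∀ x, Integrable V (P k x)) {b : ℝ}
    (hb : ∀ k, 1 ≤ k → ∀ x, ∫ y, V y ∂(P k x) ≤ V x + b) (n : ℕ) :
    Integrable V (iterKernel P n ∘ₘ μ) ∧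
      ∫ y, V y ∂(iterKernel P n ∘ₘ μ) ≤ ∫ x, V x ∂μ + n * b := by
  induction n with
  | zero =>
    have : iterKernel P 0 ∘ₘ μ = μ := Measure.id_comp
    rw [this]
    exact ⟨hVμ, by simp⟩
  | succ n ih =>
    rw [iterKernel_succ_comp]
    obtain ⟨h1, h2⟩ := integrable_comp_of_integral_le hV hV1 ih.1
      (hVP (n + 1) n.succ_pos) (hb (n + 1) n.succ_pos)
    refine ⟨h1, h2.trans ?_⟩
    push_cast
    linarith [ih.2]

/-- A function bounded below cannot decrease by a fixed amount at each step. -/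
lemma neg_drift_false (P : ℕ → Kernel X X) [∀ k, IsMarkovKernel (P k)] {μ : Measure X}
    [IsProbabilityMeasure μ] {V : X → ℝ} (hV : Measurable V) (hV1 : ∀ x, 1 ≤ V x)
    (hVμ : Integrable V μ) (hVP : ∀ k, 1 ≤ k → ∀ x, Integrable V (P k x)) {η : ℝ} (hη : 0 < η)
    (hb : ∀ k, 1 ≤ k → ∀ x, ∫ y, V y ∂(P k x) ≤ V x - η) : False := by
  obtain ⟨n, hn⟩ := exists_nat_gt ((∫ x, V x ∂μ) / η)
  obtain ⟨h1, h2⟩ := integrable_iterKernel P hV hV1 hVμ hVP (b := -η)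
    (fun k hk x => by linarith [hb k hk x]) n
  have h3 : (1 : ℝ) ≤ ∫ y, V y ∂(iterKernel P n ∘ₘ μ) := by
    have := integral_mono (integrable_const (1 : ℝ)) h1 hV1
    simpa using this
  rw [div_lt_iff₀ hη] at hn
  linarith

lemma marginal_comp {κ : Kernel X X} {J : Kernel (X × X) X} {K : Kernel (X × X) (X × X)}
    {p : X × X → X} (hp : Measurable p) (hK : ∀ z, (K z).map p + J z = κ (p z))
    {lam : Measure (X × X)} {ρ η : Measure X} (h : lam.map p + ρ = η) :
    (K ∘ₘ lam).map p + (κ ∘ₘ ρ + J ∘ₘ lam) = κ ∘ₘ η := by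
  ext A hA
  rw [← h, Measure.coe_add, Measure.coe_add, Pi.add_apply, Pi.add_apply,
    Measure.map_apply hp hA, Measure.bind_apply (hp hA) K.aemeasurable,
    Measure.bind_apply hA κ.aemeasurable, Measure.bind_apply hA J.aemeasurable,
    Measure.bind_apply hA κ.aemeasurable, lintegral_add_measure,
    lintegral_map (κ.measurable_coe hA) hp, ← add_assoc, add_right_comm,
    ← lintegral_add_left (K.measurable_coe (hp hA))]
  congr 1
  refine lintegral_congr fun z => ?_
  rw [← hK z, Measure.coe_add, Pi.add_apply, Measure.map_apply hp hA]

/-- The law of the pair of chains that have not been coupled up to time `n`. -/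
noncomputable def uncoupledLaw (K : ℕ → Kernel (X × X) (X × X)) (μ : Measure (X × X)) :
    ℕ → Measure (X × X)
  | 0 => μ
  | n + 1 => K n ∘ₘ uncoupledLaw K μ n

lemma uncoupledLaw_marginals (P : ℕ → Kernel X X) (K : ℕ → Kernel (X × X) (X × X))
    (J : ℕ → Kernel (X × X) X)
    (hK : ∀ n z, (K n z).map Prod.fst + J n z = P (n + 1) z.1 ∧
      (K n z).map Prod.snd + J n z = P (n + 1) z.2)
    (μ₁ μ₂ : Measure X) [IsProbabilityMeasure μ₁] [IsProbabilityMeasure μ₂] (n : ℕ) :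
    ∃ ρ, (uncoupledLaw K (μ₁.prod μ₂) n).map Prod.fst + ρ = iterKernel P n ∘ₘ μ₁ ∧
      (uncoupledLaw K (μ₁.prod μ₂) n).map Prod.snd + ρ = iterKernel P n ∘ₘ μ₂ := by
  induction n with
  | zero =>
    refine ⟨0, ?_, ?_⟩
    · rw [add_zero, show iterKernel P 0 ∘ₘ μ₁ = μ₁ from Measure.id_comp]
      simp [uncoupledLaw]
    · rw [add_zero, show iterKernel P 0 ∘ₘ μ₂ = μ₂ from Measure.id_comp]
      simp [uncoupledLaw]
  | succ n ih =>
    obtain ⟨ρ, h1, h2⟩ := ih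
    rw [iterKernel_succ_comp, iterKernel_succ_comp]
    exact ⟨_, marginal_comp measurable_fst (fun z => (hK n z).1) h1,
      marginal_comp measurable_snd (fun z => (hK n z).2) h2⟩

lemma lintegral_sum_uncoupledLaw_le (K : ℕ → Kernel (X × X) (X × X)) (μ : Measure (X × X))
    {g G : ℕ → X × X → ENNReal} (hG : ∀ n, Measurable (G n)) (hg : ∀ n, Measurable (g n))
    (h : ∀ n z, ∫⁻ y, G (n + 1) y ∂(K n z) + g n z ≤ G n z) :
    ∑' n, ∫⁻ z, g n z ∂(uncoupledLaw K μ n) ≤ ∫⁻ z, G 0 z ∂μ := by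
  have key : ∀ N, ∑ n ∈ Finset.range N, ∫⁻ z, g n z ∂(uncoupledLaw K μ n) +
      ∫⁻ z, G N z ∂(uncoupledLaw K μ N) ≤ ∫⁻ z, G 0 z ∂μ := by
    intro N
    induction N with
    | zero => simp [uncoupledLaw]
    | succ N ih =>
      refine le_trans ?_ ih
      rw [Finset.sum_range_succ, add_assoc]
      gcongr
      rw [uncoupledLaw, Measure.lintegral_bind (K N).aemeasurable (hG _).aemeasurable,
        ← lintegral_add_left (hg N)]
      exact lintegral_mono fun z => by rw [add_comm]; exact h N z
  exact ENNReal.tsum_le_of_sum_range_le fun N => le_self_add.trans (key N)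

/-- Two measures sharing a common part integrate a function to values whose difference is
controlled by the remaining parts. -/
lemma enorm_integral_sub_le_of_common {lam : Measure (X × X)} {ρ η₁ η₂ : Measure X}
    (h1 : lam.map Prod.fst + ρ = η₁) (h2 : lam.map Prod.snd + ρ = η₂) {f : X → ℝ}
    (hf : Measurable f) (hf1 : Integrable f η₁) (hf2 : Integrable f η₂) :
    ENNReal.ofReal |∫ x, f x ∂η₁ - ∫ x, f x ∂η₂| ≤
      ∫⁻ z, ENNReal.ofReal (|f z.1| + |f z.2|) ∂lam := by
  subst h1 h2
  have a1 := hf1.mono_measure (Measure.le_add_right le_rfl : lam.map Prod.fst ≤ _)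
  have a2 := hf2.mono_measure (Measure.le_add_right le_rfl : lam.map Prod.snd ≤ _)
  have a3 := hf1.mono_measure (Measure.le_add_left le_rfl : ρ ≤ lam.map Prod.fst + ρ)
  rw [integral_add_measure a1 a3, integral_add_measure a2 a3, add_sub_add_right_eq_sub,
    integral_map measurable_fst.aemeasurable hf.aestronglyMeasurable,
    integral_map measurable_snd.aemeasurable hf.aestronglyMeasurable,
    ← integral_sub (f := fun z : X × X => f z.1) (g := fun z => f z.2)
      (a1.comp_measurable measurable_fst) (a2.comp_measurable measurable_snd),
    ← Real.norm_eq_abs, ofReal_norm]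
  refine (enorm_integral_le_lintegral_enorm _).trans (lintegral_mono fun z => ?_)
  rw [← ofReal_norm, Real.norm_eq_abs]
  exact ENNReal.ofReal_le_ofReal (abs_sub _ _)

end Marginals

lemma pairLyapunov_zero_le {X : Type*} {C : Set X} {V : X → ℝ} {b εν ε φ₁ : ℝ}
    {r c : ℕ → ℝ} {h : ℕ → ℝ → ℝ} (hV1 : ∀ x, 1 ≤ V x) (hh : ∀ a, 1 ≤ a → h 0 a = a - 1)
    (hr0 : r 0 = 1) (hr1 : 1 ≤ r 1) (hc : 0 ≤ c 0) (hb : 0 ≤ b) (hεν : 0 < εν) (hε : 0 < ε)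
    (hφ : 0 < φ₁) (z : X × X) :
    pairLyapunov C V (ε * φ₁)⁻¹ b εν r c h 0 z ≤
      2 / (ε * φ₁) * (2 + (2 * b + ε * φ₁) / εν +
        c 0 * (2 * b + ε * φ₁) * r 1 * (1 + r 1 / (ε * φ₁))) * (V z.1 + V z.2 - 1) := by
  classical
  set W := V z.1 + V z.2 - 1 with hW
  have hW1 : 1 ≤ W := by linarith [hV1 z.1, hV1 z.2]
  set k := (ε * φ₁)⁻¹ with hk
  have hεφ : 0 < ε * φ₁ := mul_pos hε hφ
  have hk0 : 0 < k := inv_pos.2 hεφ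
  rw [pairLyapunov, hr0, ← hW, hh W hW1, div_one, zero_add]
  have hT : r 1 + (if z ∈ C ×ˢ C then 0 else r 1 * (r 1 - 1) * k * (W - 1)) ≤
      r 1 * (1 + r 1 * k) * W := by
    have h0 : 0 ≤ r 1 * (r 1 - 1) * k * (W - 1) :=
      mul_nonneg (mul_nonneg (mul_nonneg (by linarith) (by linarith)) hk0.le) (by linarith)
    have h1 : r 1 * (r 1 - 1) * k * (W - 1) ≤ r 1 * r 1 * k * W := by
      have : 0 ≤ r 1 - 1 := by linarith
      have : 0 ≤ W - 1 := by linarith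
      gcongr <;> linarith
    have h2 : r 1 ≤ r 1 * W := le_mul_of_one_le_right (by linarith) hW1
    split_ifs <;> linarith
  have e : 2 / (ε * φ₁) * (2 + (2 * b + ε * φ₁) / εν +
        c 0 * (2 * b + ε * φ₁) * r 1 * (1 + r 1 / (ε * φ₁))) * W =
      k * ((4 + 2 * (2 * b + ε * φ₁) / εν) * W +
        2 * (2 * b + ε * φ₁) * (c 0 * (r 1 * (1 + r 1 * k) * W))) := by
    rw [div_eq_mul_inv (r 1), div_eq_mul_inv 2, ← hk]
    ring
  rw [e]
  refine mul_le_mul_of_nonneg_left ?_ hk0.le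
  have h1 := mul_le_mul_of_nonneg_left hT hc
  have h2 : 0 ≤ c 0 * (r 1 * (1 + r 1 * k) * W) := by positivity
  have h3 := mul_le_mul_of_nonneg_left h1 (show 0 ≤ 4 * b by linarith)
  have h4 : 2 * b / εν ≤ 2 * (2 * b + ε * φ₁) / εν * W := by
    have : 2 * b / εν ≤ 2 * (2 * b + ε * φ₁) / εν := by gcongr; linarith
    exact this.trans (le_mul_of_one_le_right (by positivity) hW1)
  have h5 : 0 ≤ ε * φ₁ * (c 0 * (r 1 * (1 + r 1 * k) * W)) := by positivity
  linarith

lemma exists_cstar_recursion {φ : ℝ → ℝ} {εb εν bV cV : ℝ} (hεν : εν ∈ Ioo (0 : ℝ) 1)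
    (hM : 0 ≤ Mone φ εb εν bV cV) (hδ : ∀ n, 0 ≤ deltaSeq φ εb n)
    (hanti : Antitone (deltaSeq φ εb)) (hlim : Tendsto (deltaSeq φ εb) atTop (nhds 0)) :
    ∃ c : ℕ → ℝ, c 0 = cstar φ εb εν bV cV ∧ ∀ n, 0 ≤ c n ∧ c (n + 1) ≤ c n ∧
      c n = 1 + (1 - εν) * (1 + deltaSeq φ εb (n + 1) * Mone φ εb εν bV cV) * c (n + 1) := by
  have h1 : 0 < 1 - εν := sub_pos.2 hεν.2
  obtain ⟨c, hc0, hc⟩ := exists_tail_recursion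
    (a := fun k => (1 - εν) * (1 + deltaSeq φ εb k * Mone φ εb εν bV cV)) (l := 1 - εν)
    (fun n => mul_pos h1 (by have := mul_nonneg (hδ n) hM; linarith))
    (fun m n hmn => by have := hanti hmn; simp only; gcongr)
    (by simpa using ((hlim.mul_const (Mone φ εb εν bV cV)).const_add 1).const_mul (1 - εν))
    (by linarith [hεν.1])
  refine ⟨c, ?_, hc⟩
  rw [hc0, cstar]
  refine tsum_congr fun j => ?_
  rw [Finset.prod_mul_distrib, Finset.prod_const, Finset.card_range]
  congr 1
  rw [Finset.range_eq_Ico, Finset.prod_Ico_add' (fun k => 1 + deltaSeq φ εb k * Mone φ εb εν bV cV)]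
  rfl


/-- Remark 2.4(iv): the main bound for pairs of initial distributions. -/
theorem statement2 {X : Type*} [MeasurableSpace X]
    (P : ℕ → Kernel X X) (hP : ∀ k, IsMarkovKernel (P k))
    (C : Set X) (hC : MeasurableSet C)
    (V : X → ℝ) (hVmeas : Measurable V) (hV1 : ∀ x, 1 ≤ V x)
    (φ : ℝ → ℝ)
    (hφconc : ConcaveOn ℝ (Set.Ici 1) φ)
    (hφmono : MonotoneOn φ (Set.Ici 1))
    (hφdiff : ∀ t, 1 ≤ t → DifferentiableAt ℝ φ t)
    (hφpos : ∀ t, 1 ≤ t → 0 < φ t)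
    (hφderiv0 : Tendsto (deriv φ) atTop (nhds 0))
    (ν : ℕ → Measure X) (hν : ∀ k, IsProbabilityMeasure (ν k))
    (εν εb : ℝ) (hεν : εν ∈ Set.Ioo (0:ℝ) 1) (hεb : εb ∈ Set.Ioo (0:ℝ) 1)
    (bV cV : ℝ)
    (hVint : ∀ k, 1 ≤ k → ∀ x, Integrable V (P k x))
    (hdrift : ∀ k, 1 ≤ k → ∀ x,
      ∫ y, V y ∂(P k x) ≤ V x - φ (V x) + bV * C.indicator 1 x)
    (hminor : ∀ k, 1 ≤ k → ∀ x ∈ C, ∀ A : Set X, MeasurableSet A →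
      ENNReal.ofReal εν * ν k A ≤ P k x A)
    (hout : ∀ x ∉ C, bV / (1 - εb) ≤ φ (V x))
    (hin : ∀ x ∈ C, V x ≤ cV)
    (Ψ₁ Ψ₂ : ℝ → ℝ)
    (hΨ₁mono : MonotoneOn Ψ₁ (Set.Ici 1)) (hΨ₂mono : MonotoneOn Ψ₂ (Set.Ici 1))
    (hΨ₁pos : ∀ t, 1 ≤ t → 0 < Ψ₁ t) (hΨ₂pos : ∀ t, 1 ≤ t → 0 < Ψ₂ t)
    (hYoung : ∀ x y : ℝ, 1 ≤ x → 1 ≤ y → Ψ₁ x * Ψ₂ y ≤ x + y)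
    (f : X → ℝ) (hfmeas : Measurable f)
    (Mf : ℝ) (hfW : ∀ x, |f x| ≤ Mf * Ψ₂ (φ (V x) / φ 1))
    (μ₁ μ₂ : Measure X) (hμ₁ : IsProbabilityMeasure μ₁) (hμ₂ : IsProbabilityMeasure μ₂)
    (hμ₁V : Integrable V μ₁) (hμ₂V : Integrable V μ₂) :
    ∑' n : ℕ, ENNReal.ofReal (Ψ₁ (rate φ εb n) *
        |(∫ x, (∫ y, f y ∂(iterKernel P n x)) ∂μ₁) -
          ∫ x, (∫ y, f y ∂(iterKernel P n x)) ∂μ₂|) ≤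
      ENNReal.ofReal (cconst φ εb εν bV cV *
        ((∫ x, V x ∂μ₁) + (∫ x, V x ∂μ₂) - 1) * Mf) := by
  have hφ : IsDriftFunction φ := ⟨hφconc, hφmono, hφdiff, hφpos, hφderiv0⟩
  have hφ1 : 0 < φ 1 := hφpos 1 le_rfl
  obtain ⟨h, s, hfam⟩ := hφ.exists_rateFamily hεb.1
  have hφV : ∀ x, φ 1 ≤ φ (V x) := fun x => hφmono (mem_Ici.2 le_rfl) (hV1 x) (hV1 x)
  have hφVm : Measurable fun x => φ (V x) := by
    have : (fun x => φ (V x)) = fun x => extendLeft φ (V x) :=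
      funext fun x => (extendLeft_of_le (hV1 x)).symm
    rw [this]
    exact hφ.extend_continuous.measurable.comp hVmeas
  have hy : ∀ x, 1 ≤ φ (V x) / φ 1 := fun x => (one_le_div hφ1).2 (hφV x)
  -- nondegeneracy of the drift condition
  have hbφ : φ 1 ≤ bV := by
    by_contra! hlt
    refine neg_drift_false P hVmeas hV1 hμ₁V hVint (lt_min hφ1 (sub_pos.2 hlt)) fun k hk x => ?_
    have h1 := hdrift k hk x
    have h2 := hφV x
    by_cases hx : x ∈ C
    · simp only [hx, indicator_of_mem, Pi.one_apply] at h1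
      linarith [min_le_right (φ 1) (φ 1 - bV)]
    · simp only [hx, not_false_eq_true, indicator_of_notMem] at h1
      linarith [min_le_left (φ 1) (φ 1 - bV)]
  have hb : 0 < bV := hφ1.trans_le hbφ
  have hCne : C.Nonempty := by
    by_contra hne
    refine neg_drift_false P hVmeas hV1 hμ₁V hVint hφ1 fun k hk x => ?_
    have h1 := hdrift k hk x
    have hx : x ∉ C := fun hx => hne ⟨x, hx⟩
    simp only [hx, not_false_eq_true, indicator_of_notMem] at h1
    linarith [hφV x]
  obtain ⟨x₀, hx₀⟩ := hCne
  have hcV : 1 ≤ cV := (hV1 x₀).trans (hin x₀ hx₀)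
  have hM0 : 0 ≤ Mf := by
    have := (abs_nonneg _).trans (hfW x₀)
    exact nonneg_of_mul_nonneg_left this (hΨ₂pos _ (hy x₀))
  have hεν1 : 0 < 1 - εν := sub_pos.2 hεν.2
  set q := (bV + cV) / (1 - εν) - 1 with hq
  have hq0 : 0 ≤ q := by
    rw [hq, sub_nonneg, le_div_iff₀ hεν1]
    linarith [hεν.1]
  have hqeq : (1 - εν) * (q + 1) = bV + cV := by rw [hq]; field_simp; ring
  have hεφ : 0 < εb * φ 1 := mul_pos hεb.1 hφ1
  have hMone : Mone φ εb εν bV cV =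
      rate φ εb 1 * (1 + 2 * rate φ εb 1 * (εb * φ 1)⁻¹ * q) := by
    rw [Mone, hq]; ring
  have hr := hfam.one_le_rate
  have hMone0 : 0 ≤ Mone φ εb εν bV cV := by
    have := zero_le_one.trans (hr 1)
    rw [hMone]
    positivity
  obtain ⟨c, hc0, hc⟩ := exists_cstar_recursion hεν hMone0 hfam.delta_nonneg hfam.delta_antitone
    hfam.delta_tendsto
  have hc' := hc
  rw [hMone] at hc'
  have hmin : ∀ n, ∀ x ∈ C, ENNReal.ofReal εν • ν (n + 1) ≤ P (n + 1) x := fun n x hx =>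
    Measure.le_iff.2 fun A hA => hminor (n + 1) n.succ_pos x hx A hA
  choose K hK using fun n => exists_uncoupled_kernel (P (n + 1)) hC (ν (n + 1)) hεν (hmin n)
  have hmarg := uncoupledLaw_marginals P K (fun n => coupledPart hC (ν (n + 1)) εν) hK μ₁ μ₂
  set lam := uncoupledLaw K (μ₁.prod μ₂) with hlam
  set w : ℕ → X × X → ℝ := fun n z => 2 * rate φ εb n + (φ (V z.1) + φ (V z.2)) / φ 1 with hw
  have hdescent := fun n => pairLyapunov_descent hφ hfam hC hV1 hVmeas hεb hεν hb.le hq0 hqeq rfl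
    hout hin hc' (P (n + 1)) (ν (n + 1)) (hVint _ n.succ_pos) (hdrift _ n.succ_pos) (K n) (hK n) n
  have hwm : ∀ n, Measurable (w n) := fun n =>
    (((hφVm.comp measurable_fst).add (hφVm.comp measurable_snd)).div_const _).const_add _
  have hsum := lintegral_sum_uncoupledLaw_le K (μ₁.prod μ₂)
    (g := fun n z => ENNReal.ofReal (w n z))
    (fun n => (measurable_pairLyapunov hC hVmeas hfam.measurable n).ennreal_ofReal)
    (fun n => (hwm n).ennreal_ofReal) hdescent
  -- integrability of the test function
  have hΨf : ∀ n x, Ψ₁ (rate φ εb n) * |f x| ≤ Mf * (rate φ εb n + φ (V x) / φ 1) := fun n x =>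
    calc Ψ₁ (rate φ εb n) * |f x| ≤ Ψ₁ (rate φ εb n) * (Mf * Ψ₂ (φ (V x) / φ 1)) :=
          mul_le_mul_of_nonneg_left (hfW x) (hΨ₁pos _ (hr n)).le
      _ = Mf * (Ψ₁ (rate φ εb n) * Ψ₂ (φ (V x) / φ 1)) := by ring
      _ ≤ _ := mul_le_mul_of_nonneg_left (hYoung _ _ (hr n) (hy x)) hM0
  have hfint : ∀ (μ : Measure X) [IsProbabilityMeasure μ], Integrable V μ → ∀ n,
      Integrable f (iterKernel P n ∘ₘ μ) := by
    intro μ _ hμV n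
    have hVn := (integrable_iterKernel P hVmeas hV1 hμV hVint (b := bV) (fun k hk x => by
      have h1 := hdrift k hk x
      have h2 : bV * C.indicator 1 x ≤ bV * 1 :=
        mul_le_mul_of_nonneg_left (indicator_le_self' (fun _ _ => zero_le_one) x) hb.le
      linarith [hφV x]) n).1
    have hΨ := hΨ₁pos _ (hr 0)
    refine Integrable.mono' ((((integrable_const (rate φ εb 0)).add ((hVn.const_mul
      (φ 1 + deriv φ 1)).div_const (φ 1))).const_mul Mf).div_const (Ψ₁ (rate φ εb 0)))
      hfmeas.aestronglyMeasurable (Eventually.of_forall fun x => ?_)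
    simp only [Pi.add_apply]
    rw [Real.norm_eq_abs, le_div_iff₀ hΨ, mul_comm]
    refine (hΨf 0 x).trans ?_
    have := hφ.le_linear (hV1 x)
    gcongr
  have hstep : ∀ n, ENNReal.ofReal (Ψ₁ (rate φ εb n) *
      |(∫ x, (∫ y, f y ∂(iterKernel P n x)) ∂μ₁) - ∫ x, (∫ y, f y ∂(iterKernel P n x)) ∂μ₂|) ≤
      ENNReal.ofReal Mf * ∫⁻ z, ENNReal.ofReal (w n z) ∂(lam n) := by
    intro n
    obtain ⟨ρ, h1, h2⟩ := hmarg n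
    have hf1 := hfint μ₁ hμ₁V n
    have hf2 := hfint μ₂ hμ₂V n
    have hΨ := hΨ₁pos _ (hr n)
    rw [integral_comp_measure hf1, integral_comp_measure hf2, ENNReal.ofReal_mul hΨ.le,
      ← lintegral_const_mul _ (hwm n).ennreal_ofReal]
    refine (mul_le_mul_right (enorm_integral_sub_le_of_common h1 h2 hfmeas hf1 hf2) _).trans ?_
    rw [← lintegral_const_mul _ (by fun_prop)]
    refine lintegral_mono fun z => ?_
    rw [← ENNReal.ofReal_mul hΨ.le, ← ENNReal.ofReal_mul hM0]
    refine ENNReal.ofReal_le_ofReal ?_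
    have e1 := hΨf n z.1
    have e2 := hΨf n z.2
    simp only [hw, add_div]
    linarith
  -- the initial value
  have hVi : Integrable (fun z : X × X => V z.1 + V z.2 - 1) (μ₁.prod μ₂) :=
    ((hμ₁V.comp_fst μ₂).add (hμ₂V.comp_snd μ₁)).sub (integrable_const 1)
  have hVint0 : ∫ z : X × X, (V z.1 + V z.2 - 1) ∂(μ₁.prod μ₂) =
      (∫ x, V x ∂μ₁) + (∫ x, V x ∂μ₂) - 1 := by
    rw [integral_sub (f := fun z : X × X => V z.1 + V z.2)
      ((hμ₁V.comp_fst μ₂).add (hμ₂V.comp_snd μ₁)) (integrable_const 1),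
      integral_add (f := fun z : X × X => V z.1) (g := fun z => V z.2)
      (hμ₁V.comp_fst μ₂) (hμ₂V.comp_snd μ₁), integral_fun_fst, integral_fun_snd]
    simp
  have hcc : 0 ≤ cconst φ εb εν bV cV := by
    have h1 : 0 ≤ cstar φ εb εν bV cV := hc0 ▸ (hc 0).1
    have h2 : 0 ≤ bbar φ εb bV := by rw [bbar]; positivity
    have h3 := zero_le_one.trans (hr 1)
    have h4 := hεν.1
    rw [cconst]
    positivity
  calc _ ≤ ∑' n, ENNReal.ofReal Mf * ∫⁻ z, ENNReal.ofReal (w n z) ∂(lam n) :=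
        ENNReal.tsum_le_tsum hstep
    _ = ENNReal.ofReal Mf * ∑' n, ∫⁻ z, ENNReal.ofReal (w n z) ∂(lam n) := ENNReal.tsum_mul_left
    _ ≤ ENNReal.ofReal Mf * ∫⁻ z, ENNReal.ofReal
          (cconst φ εb εν bV cV * (V z.1 + V z.2 - 1)) ∂(μ₁.prod μ₂) := by
        refine mul_le_mul_right (hsum.trans (lintegral_mono fun z => ?_)) _
        refine ENNReal.ofReal_le_ofReal ?_
        have := pairLyapunov_zero_le (C := C) hV1 hfam.zero_eq hfam.rate_zero (hr 1) (hc 0).1 hb.le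
          hεν.1 hεb.1 hφ1 z
        rwa [hc0] at this
    _ = _ := by
        rw [← ofReal_integral_eq_lintegral_ofReal (hVi.const_mul _)
          (Eventually.of_forall fun z => mul_nonneg hcc (by linarith [hV1 z.1, hV1 z.2])),
          integral_const_mul, hVint0, ← ENNReal.ofReal_mul hM0, mul_comm]
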